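/- arXiv:1703.04930 — 5 statements merged into one kernel-verified Lean document; each statement's English description precedes it below -/
import Mathlib

section
/- Let Σ₁ and Σ₂ be symmetric positive definite m×m real matrices and let α ∈ (0,1). Suppose m* > 0 is such that the function Σ ↦ −log det(Σ) is strongly convex with parameter m* (with respect to the Frobenius norm) on the segment {tΣ₁ + (1−t)Σ₂ : t ∈ [0,1]}, i.e., −log det(tΣ₁+(1−t)Σ₂) ≤ −t·log det(Σ₁) − (1−t)·log det(Σ₂) − (m*/2)·t(1−t)·‖Σ₁−Σ₂‖_F² for all t ∈ [0,1]. Then the α-Rényi divergence between the zero-mean Gaussian densities N(0,Σ₁) and N(0,Σ₂) satisfies D_α ≥ (α/4)·m*·‖Σ₂−Σ₁‖_F². -/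
open Matrix BigOperators

/-- Frobenius norm of a real matrix. -/
noncomputable def frob {ι κ : Type*} [Fintype ι] [Fintype κ] (M : Matrix ι κ ℝ) : ℝ :=
  Real.sqrt (∑ i, ∑ j, M i j ^ 2)

/-- The α-Rényi divergence between the zero-mean Gaussian densities
`N(0, S1)` and `N(0, S2)`. -/
noncomputable def renyiGauss {m : ℕ} (α : ℝ) (S1 S2 : Matrix (Fin m) (Fin m) ℝ) : ℝ :=
  (1 / (2 * (1 - α))) *
    Real.log (((1 - α) • S1 + α • S2).det / (S1.det ^ (1 - α) * S2.det ^ α))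

theorem frob_sub_comm {ι κ : Type*} [Fintype ι] [Fintype κ] (A B : Matrix ι κ ℝ) :
    frob (A - B) = frob (B - A) := by
  unfold frob
  refine congrArg _ (Finset.sum_congr rfl fun i _ => Finset.sum_congr rfl fun j _ => ?_)
  rw [Matrix.sub_apply, Matrix.sub_apply, sub_sq_comm]

/-- If `Σ ↦ -log det Σ` is strongly convex with parameter `mstar` (w.r.t. the
Frobenius norm) on the segment joining two positive definite matrices `S1, S2`, then the
α-Rényi divergence between `N(0,S1)` and `N(0,S2)` is at least
`(α/4) · mstar · ‖S2 - S1‖_F²`. -/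
theorem stmt0 {m : ℕ} (S1 S2 : Matrix (Fin m) (Fin m) ℝ)
    (h1 : S1.PosDef) (h2 : S2.PosDef) (α mstar : ℝ)
    (hα : α ∈ Set.Ioo (0 : ℝ) 1) (hm : 0 < mstar)
    (hsc : ∀ t : ℝ, t ∈ Set.Icc (0 : ℝ) 1 →
      -Real.log ((t • S1 + (1 - t) • S2).det) ≤
        -(t * Real.log S1.det) - (1 - t) * Real.log S2.det
          - (mstar / 2) * (t * (1 - t)) * frob (S1 - S2) ^ 2) :
    (α / 4) * mstar * frob (S2 - S1) ^ 2 ≤ renyiGauss α S1 S2 := by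
  obtain ⟨hα0, hα1⟩ := hα
  have hβ : 0 < 1 - α := sub_pos.mpr hα1
  have hdet : 0 < ((1 - α) • S1 + α • S2).det :=
    ((h1.smul hβ).add (h2.smul hα0)).det_pos
  have hd1 := h1.det_pos
  have hd2 := h2.det_pos
  have hconv := hsc (1 - α) ⟨hβ.le, by linarith⟩
  rw [sub_sub_cancel, frob_sub_comm S1 S2] at hconv
  rw [renyiGauss, Real.log_div hdet.ne' (by positivity), Real.log_mul (by positivity)
    (by positivity), Real.log_rpow hd1, Real.log_rpow hd2, one_div_mul_eq_div,
    le_div_iff₀ (by positivity)]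
  linarith
end

section
/- Let n, K ∈ ℕ with K ≤ n, let S* ⊆ {1,…,n} with |S*| ≤ K, and let k_d ≥ 1. Then the number of subsets S ⊆ {1,…,n} with |S| ≤ K whose symmetric difference with S* has exactly k_d elements, i.e., |(S \ S*) ∪ (S* \ S)| = k_d, is at most (3 e n K)^{k_d}. -/
open Classical in
/-- The number of subsets `S ⊆ {1,…,n}` with `|S| ≤ K` whose symmetric difference with a
fixed set `S*` (of size at most `K ≤ n`) has exactly `k_d ≥ 1` elements is at most
`(3 e n K)^{k_d}`. -/
theorem stmt9 {n : ℕ} (K : ℕ) (hK : K ≤ n) (Sstar : Finset (Fin n))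
    (hS : Sstar.card ≤ K) (kd : ℕ) (hkd : 1 ≤ kd) :
    ((Finset.univ.filter (fun S : Finset (Fin n) =>
        S.card ≤ K ∧ (S \ Sstar ∪ Sstar \ S).card = kd)).card : ℝ) ≤
      (3 * Real.exp 1 * (n : ℝ) * (K : ℝ)) ^ kd := by
  rcases Nat.eq_zero_or_pos K with rfl | hKpos
  · have hempty : Sstar = ∅ := Finset.card_eq_zero.mp (Nat.le_zero.mp hS)
    subst hempty
    rw [Finset.filter_eq_empty_iff.mpr]
    · simp only [Finset.card_empty, Nat.cast_zero]
      positivity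
    · rintro S - ⟨hS0, hd⟩
      rw [Finset.card_eq_zero.mp (Nat.le_zero.mp hS0)] at hd
      simp at hd
      omega
  · have hcard : (Finset.univ.filter (fun S : Finset (Fin n) =>
        S.card ≤ K ∧ (S \ Sstar ∪ Sstar \ S).card = kd)).card ≤ n ^ kd := by
      calc _ ≤ (Finset.powersetCard kd (Finset.univ : Finset (Fin n))).card := by
            refine Finset.card_le_card_of_injOn (fun S => S \ Sstar ∪ Sstar \ S) ?_ ?_
            · intro S hmem
              simp only [Finset.coe_filter, Finset.mem_univ, true_and, Set.mem_ofPred_eq] at hmem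
              simp [Finset.mem_powersetCard, hmem.2]
            · intro S _ T _ hST
              exact symmDiff_left_injective Sstar hST
        _ = n.choose kd := by simp
        _ ≤ n ^ kd := Nat.choose_le_pow n kd
    calc _ ≤ (n : ℝ) ^ kd := by exact_mod_cast hcard
      _ ≤ _ := by
        refine pow_le_pow_left₀ (Nat.cast_nonneg n) ?_ kd
        have hK1 : (1 : ℝ) ≤ K := by exact_mod_cast hKpos
        have he : (1 : ℝ) ≤ Real.exp 1 := Real.one_le_exp zero_le_one
        have hc : (1 : ℝ) ≤ (3 * Real.exp 1) * K :=
          one_le_mul_of_one_le_of_one_le (by linarith) hK1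
        calc (n : ℝ) ≤ n * ((3 * Real.exp 1) * K) := le_mul_of_one_le_right (Nat.cast_nonneg n) hc
          _ = _ := by ring
end

section
/- Let A be a real m×n matrix, σ² > 0, S ⊆ {1,…,n}, and let γ ∈ ℝ^n be supported on S with γ(i) ≥ γ_min > 0 for all i ∈ S. Then tr( A_S^T (σ² I_m + A_S diag(γ_S) A_S^T)^{-1} A_S ) ≤ min(m, |S|) / γ_min, where A_S is the submatrix of A formed by the columns indexed by S and γ_S is the restriction of γ to S. -/
open Matrix BigOperators

/-- Submatrix of `A` made of the columns indexed by `S`. -/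
def colsub {m n : ℕ} (A : Matrix (Fin m) (Fin n) ℝ) (S : Finset (Fin n)) :
    Matrix (Fin m) {x // x ∈ S} ℝ :=
  A.submatrix id (fun j => j.1)

section RegularizedGram

variable {ι κ : Type*} [Fintype ι] [DecidableEq ι] [Fintype κ] [DecidableEq κ]

/-- The regularized weighted Gram matrix `s I + B diag(d) Bᵀ` is positive definite. -/
theorem posDef_smul_one_add_mul_diagonal_mul_transpose (B : Matrix ι κ ℝ) {s : ℝ} (hs : 0 < s)
    {d : κ → ℝ} (hd : ∀ i, 0 ≤ d i) :
    (s • (1 : Matrix ι ι ℝ) + B * diagonal d * Bᵀ).PosDef := by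
  refine (PosDef.one.smul hs).add_posSemidef ?_
  simpa using (PosSemidef.diagonal (d := d) hd).mul_mul_conjTranspose_same B

/-- The weighted trace of `Bᵀ (s I + B diag(d) Bᵀ)⁻¹ B` is at most the number of rows of `B`. -/
theorem sum_mul_diag_transpose_mul_inv_mul_le (B : Matrix ι κ ℝ) {s : ℝ} (hs : 0 < s)
    {d : κ → ℝ} (hd : ∀ i, 0 ≤ d i) :
    ∑ i, d i * (Bᵀ * (s • (1 : Matrix ι ι ℝ) + B * diagonal d * Bᵀ)⁻¹ * B) i i
      ≤ Fintype.card ι := by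
  have hM := posDef_smul_one_add_mul_diagonal_mul_transpose B hs hd
  set M := s • (1 : Matrix ι ι ℝ) + B * diagonal d * Bᵀ with hMdef
  have hdet : IsUnit M.det := (isUnit_iff_isUnit_det M).mp hM.isUnit
  have htr : 0 ≤ M⁻¹.trace := hM.inv.posSemidef.trace_nonneg
  calc ∑ i, d i * (Bᵀ * M⁻¹ * B) i i
      = (diagonal d * (Bᵀ * M⁻¹ * B)).trace := by simp [trace, diagonal_mul]
    _ = (B * diagonal d * Bᵀ * M⁻¹).trace := by
        rw [← Matrix.mul_assoc, trace_mul_comm]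
        simp only [Matrix.mul_assoc]
    _ = ((M - s • (1 : Matrix ι ι ℝ)) * M⁻¹).trace := by rw [hMdef, add_sub_cancel_left]
    _ = Fintype.card ι - s * M⁻¹.trace := by
        rw [Matrix.sub_mul, mul_nonsing_inv M hdet]
        simp
    _ ≤ Fintype.card ι := by nlinarith

/-- The diagonal entries of `Bᵀ (s I + B diag(d) Bᵀ)⁻¹ B` are nonnegative, and at most `1` after
multiplication by the corresponding weight. -/
theorem diag_transpose_mul_inv_mul_bounds (B : Matrix ι κ ℝ) {s : ℝ} (hs : 0 < s)
    {d : κ → ℝ} (hd : ∀ i, 0 ≤ d i) (i : κ) :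
    0 ≤ (Bᵀ * (s • (1 : Matrix ι ι ℝ) + B * diagonal d * Bᵀ)⁻¹ * B) i i ∧
      d i * (Bᵀ * (s • (1 : Matrix ι ι ℝ) + B * diagonal d * Bᵀ)⁻¹ * B) i i ≤ 1 := by
  have hM := posDef_smul_one_add_mul_diagonal_mul_transpose B hs hd
  set M := s • (1 : Matrix ι ι ℝ) + B * diagonal d * Bᵀ with hMdef
  have hdet : IsUnit M.det := (isUnit_iff_isUnit_det M).mp hM.isUnit
  have hsymm : M⁻¹ᵀ = M⁻¹ := by simpa using hM.inv.isHermitian.eq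
  set T := Bᵀ * M⁻¹ * B with hT
  have hTsymm : Tᵀ = T := by simp [hT, hsymm, Matrix.mul_assoc]
  have hdecomp : T = s • ((M⁻¹ * B)ᵀ * (M⁻¹ * B)) + T * diagonal d * Tᵀ := by
    calc T = Bᵀ * M⁻¹ * M * M⁻¹ * B := by
          rw [nonsing_inv_mul_cancel_right _ _ hdet]
      _ = Bᵀ * M⁻¹ * (s • (1 : Matrix ι ι ℝ) + B * diagonal d * Bᵀ) * M⁻¹ * B := by rw [← hMdef]
      _ = _ := by
          rw [hTsymm, hT, transpose_mul, hsymm]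
          simp [Matrix.mul_add, Matrix.add_mul, Matrix.mul_assoc]
  have hentry : T i i = s * ∑ k, (M⁻¹ * B) k i ^ 2 + ∑ j, d j * T i j ^ 2 := by
    refine (congrArg (fun X : Matrix κ κ ℝ => X i i) hdecomp).trans ?_
    simp only [Matrix.add_apply, Matrix.smul_apply, smul_eq_mul, mul_apply (M := (M⁻¹ * B)ᵀ),
      mul_apply (M := T * diagonal d), mul_diagonal, transpose_apply]
    congr 1
    · congr 1
      exact Finset.sum_congr rfl fun k _ => by ring
    · exact Finset.sum_congr rfl fun j _ => by ring
  have hfirst : 0 ≤ s * ∑ k, (M⁻¹ * B) k i ^ 2 := by positivity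
  have hsecond : d i * T i i ^ 2 ≤ ∑ j, d j * T i j ^ 2 :=
    Finset.single_le_sum (f := fun j => d j * T i j ^ 2)
      (fun j _ => mul_nonneg (hd j) (sq_nonneg _)) (Finset.mem_univ i)
  have hsq : 0 ≤ d i * T i i ^ 2 := mul_nonneg (hd i) (sq_nonneg _)
  refine ⟨by linarith, ?_⟩
  by_contra! hlt
  have hpos : 0 < T i i := by
    by_contra! hle
    nlinarith [hd i]
  nlinarith

end RegularizedGram

/-- For `γ` supported on `S` with entries at least `γmin > 0` on `S`,
`tr(A_Sᵀ (σ² I + A_S diag(γ_S) A_Sᵀ)⁻¹ A_S) ≤ min(m, |S|)/γmin`. -/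
theorem stmt11 {m n : ℕ} (A : Matrix (Fin m) (Fin n) ℝ) (σ2 : ℝ) (hσ : 0 < σ2)
    (S : Finset (Fin n)) (γ : Fin n → ℝ) (γmin : ℝ) (h0 : 0 < γmin)
    (hsupp : ∀ i, i ∉ S → γ i = 0) (hge : ∀ i ∈ S, γmin ≤ γ i) :
    ((colsub A S)ᵀ *
        (σ2 • (1 : Matrix (Fin m) (Fin m) ℝ) +
          colsub A S * Matrix.diagonal (fun i : {x // x ∈ S} => γ i.1) * (colsub A S)ᵀ)⁻¹ *
        colsub A S).trace ≤ (min m S.card : ℝ) / γmin := by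
  have hge' : ∀ i : {x // x ∈ S}, γmin ≤ γ i.1 := fun i => hge i.1 i.2
  have hd : ∀ i : {x // x ∈ S}, 0 ≤ γ i.1 := fun i => h0.le.trans (hge' i)
  have hrows := sum_mul_diag_transpose_mul_inv_mul_le (colsub A S) hσ hd
  have hdiag := diag_transpose_mul_inv_mul_bounds (colsub A S) hσ hd
  set T := (colsub A S)ᵀ *
    (σ2 • (1 : Matrix (Fin m) (Fin m) ℝ) +
      colsub A S * Matrix.diagonal (fun i : {x // x ∈ S} => γ i.1) * (colsub A S)ᵀ)⁻¹ *
    colsub A S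
  have hweight : T.trace * γmin ≤ ∑ i, γ i.1 * T i i := by
    rw [trace, Finset.sum_mul]
    refine Finset.sum_le_sum fun i _ => ?_
    rw [diag_apply, mul_comm]
    exact mul_le_mul_of_nonneg_right (hge' i) (hdiag i).1
  have hcols : ∑ i, γ i.1 * T i i ≤ S.card := by
    simpa using Finset.sum_le_sum fun i (_ : i ∈ Finset.univ) => (hdiag i).2
  rw [le_div_iff₀ h0]
  refine hweight.trans (le_min ?_ hcols)
  simpa using hrows
end

section
/- Let A be a real m×n matrix such that any K+1 columns of A are linearly independent (i.e., spark(A) > K+1). Let 0 < γ_min ≤ γ_max and let γ₁, γ₂ ∈ Θ_K with supp(γ₁) \ supp(γ₂) ≠ ∅. Then there exists a constant c₁ > 0, depending only on A, γ₁ and γ₂ but not on σ², such that for every σ² > 0 the largest eigenvalue of H := Σ_{γ₁}^{1/2} Σ_{γ₂}^{-1} Σ_{γ₁}^{1/2} satisfies λ_max(H) ≥ c₁ / σ², where Σ_{γ_i} := σ² I_m + A diag(γ_i) A^T. -/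
open Matrix BigOperators

open Classical in
/-- Support of a vector, as a finset. -/
noncomputable def suppF {ι : Type*} [Fintype ι] (x : ι → ℝ) : Finset ι :=
  Finset.univ.filter (fun i => x i ≠ 0)

/-- `γ ∈ Θ_K`: `γ` has at most `K` nonzero entries, all lying in `[γmin, γmax]`. -/
def InThetaK {n : ℕ} (γ : Fin n → ℝ) (K : ℕ) (γmin γmax : ℝ) : Prop :=
  (suppF γ).card ≤ K ∧ ∀ i, γ i ≠ 0 → γmin ≤ γ i ∧ γ i ≤ γmax

/-- `Σ_γ = σ² I_m + A diag(γ) Aᵀ`. -/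
noncomputable def SigMat {m n : ℕ} (A : Matrix (Fin m) (Fin n) ℝ) (σ2 : ℝ)
    (γ : Fin n → ℝ) : Matrix (Fin m) (Fin m) ℝ :=
  σ2 • (1 : Matrix (Fin m) (Fin m) ℝ) + A * Matrix.diagonal γ * Aᵀ

/-- In a linearly independent family of vectors, each member can be separated from the
others by a vector orthogonal to all of them. -/
theorem exists_dotProduct_ne_zero_of_linearIndependent {ι m : Type*} [Fintype m] [DecidableEq m]
    {v : ι → m → ℝ} (hv : LinearIndependent ℝ v) (i : ι) :
    ∃ w : m → ℝ, w ⬝ᵥ v i ≠ 0 ∧ ∀ j, j ≠ i → w ⬝ᵥ v j = 0 := by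
  have hi : v i ∉ Submodule.span ℝ (v '' {i}ᶜ) := hv.notMem_span_image (by simp)
  obtain ⟨f, hf, hker⟩ := Submodule.exists_le_ker_of_notMem hi
  have key : ∀ x : m → ℝ, (fun k => f (Pi.single k 1)) ⬝ᵥ x = f x := fun x => by
    rw [LinearMap.pi_apply_eq_sum_univ f x]
    simp only [dotProduct, smul_eq_mul]
    refine Finset.sum_congr rfl fun k _ => ?_
    rw [mul_comm]
    congr 2
    ext l
    simp [Pi.single_apply, eq_comm]
  refine ⟨fun k => f (Pi.single k 1), by rwa [key], fun j hj => ?_⟩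
  rw [key]
  exact hker (Submodule.subset_span ⟨j, hj, rfl⟩)

/-- A lower bound for the Rayleigh quotient of a real symmetric matrix at some nonzero vector is
a lower bound for one of its eigenvalues. -/
theorem Matrix.IsHermitian.exists_eigenvalue_ge {m : Type*} [Fintype m] [DecidableEq m]
    {H : Matrix m m ℝ} (hH : H.IsHermitian) {μ : ℝ} {x : m → ℝ} (hx : x ≠ 0)
    (h : μ * (x ⬝ᵥ x) ≤ x ⬝ᵥ H *ᵥ x) :
    ∃ lam : ℝ, μ ≤ lam ∧ ∃ v : m → ℝ, v ≠ 0 ∧ H *ᵥ v = lam • v := by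
  have hM : (μ • (1 : Matrix m m ℝ) - H).IsHermitian := by
    refine Matrix.IsHermitian.sub ?_ hH
    ext i j
    simp [Matrix.one_apply, eq_comm]
  have hnot : ¬ ∀ i, 0 < hM.eigenvalues i := fun hpos => by
    have hx' := (hM.posDef_iff_eigenvalues_pos.2 hpos).dotProduct_mulVec_pos hx
    simp only [star_trivial, sub_mulVec, smul_mulVec, one_mulVec, dotProduct_sub,
      dotProduct_smul, smul_eq_mul] at hx'
    linarith
  push Not at hnot
  obtain ⟨i, hi⟩ := hnot
  refine ⟨μ - hM.eigenvalues i, by linarith, (hM.eigenvectorBasis i).ofLp, fun h0 => ?_, ?_⟩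
  · exact hM.eigenvectorBasis.orthonormal.ne_zero i (by ext k; exact congrFun h0 k)
  · have he := hM.mulVec_eigenvectorBasis i
    rw [sub_mulVec, smul_mulVec, one_mulVec] at he
    rw [sub_smul, ← he, sub_sub_cancel]

/-- Cauchy–Schwarz inequality for the pairing of a positive definite form with its inverse. -/
theorem Matrix.PosDef.sq_dotProduct_le {m : Type*} [Fintype m] [DecidableEq m]
    {S : Matrix m m ℝ} (hS : S.PosDef) (u w : m → ℝ) :
    (u ⬝ᵥ w) ^ 2 ≤ (w ⬝ᵥ S *ᵥ w) * (u ⬝ᵥ S⁻¹ *ᵥ u) := by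
  rcases eq_or_ne w 0 with rfl | hw
  · simp
  have hb : 0 < w ⬝ᵥ S *ᵥ w := by simpa using hS.dotProduct_mulVec_pos hw
  have hdet : IsUnit S.det := hS.det_pos.ne'.isUnit
  have hinv : S⁻¹ *ᵥ (S *ᵥ w) = w := by rw [mulVec_mulVec, nonsing_inv_mul _ hdet, one_mulVec]
  have hsymm : (S *ᵥ w) ⬝ᵥ S⁻¹ *ᵥ u = u ⬝ᵥ w := by
    have ht : Sᵀ = S := by simpa [conjTranspose_eq_transpose_of_trivial] using hS.1.eq
    rw [← ht, mulVec_transpose, ← dotProduct_mulVec, ht, mulVec_mulVec, mul_nonsing_inv _ hdet,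
      one_mulVec, dotProduct_comm]
  have hnn := hS.inv.posSemidef.dotProduct_mulVec_nonneg
    ((w ⬝ᵥ S *ᵥ w) • u - (u ⬝ᵥ w) • (S *ᵥ w))
  simp only [star_trivial, mulVec_sub, mulVec_smul, hinv, dotProduct_sub, sub_dotProduct,
    smul_dotProduct, dotProduct_smul, smul_eq_mul, hsymm, dotProduct_comm (S *ᵥ w) w] at hnn
  have : 0 ≤ (w ⬝ᵥ S *ᵥ w) * ((w ⬝ᵥ S *ᵥ w) * (u ⬝ᵥ S⁻¹ *ᵥ u) - (u ⬝ᵥ w) ^ 2) := by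
    linarith
  linarith [nonneg_of_mul_nonneg_right this hb]

theorem SigMat_posDef {m n : ℕ} (A : Matrix (Fin m) (Fin n) ℝ) {s : ℝ} (hs : 0 < s)
    {γ : Fin n → ℝ} (hγ : ∀ i, 0 ≤ γ i) : (SigMat A s γ).PosDef := by
  refine (PosDef.one.smul hs).add_posSemidef ?_
  simpa [conjTranspose_eq_transpose_of_trivial] using
    (PosSemidef.diagonal hγ).mul_mul_conjTranspose_same A

theorem dotProduct_SigMat_mulVec {m n : ℕ} (A : Matrix (Fin m) (Fin n) ℝ) (s : ℝ)
    (γ : Fin n → ℝ) (w : Fin m → ℝ) :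
    w ⬝ᵥ SigMat A s γ *ᵥ w = s * (w ⬝ᵥ w) + ∑ j, γ j * (w ⬝ᵥ Aᵀ j) ^ 2 := by
  have h : w ⬝ᵥ (A * diagonal γ * Aᵀ) *ᵥ w = ∑ j, γ j * (w ⬝ᵥ Aᵀ j) ^ 2 := by
    rw [← mulVec_mulVec, ← mulVec_mulVec, dotProduct_mulVec]
    refine Finset.sum_congr rfl fun j _ => ?_
    rw [mulVec_diagonal, mulVec, vecMul, dotProduct_comm (Aᵀ j) w]
    change w ⬝ᵥ Aᵀ j * _ = _
    ring
  rw [SigMat, add_mulVec, dotProduct_add, h, smul_mulVec, one_mulVec, dotProduct_smul, smul_eq_mul]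

theorem InThetaK.nonneg {n : ℕ} {γ : Fin n → ℝ} {K : ℕ} {γmin γmax : ℝ}
    (h : InThetaK γ K γmin γmax) (h0 : 0 < γmin) (i : Fin n) : 0 ≤ γ i := by
  by_cases hi : γ i = 0
  · exact hi.ge
  · exact h0.le.trans (h.2 i hi).1

/-- If every `K+1` columns of `A` are linearly independent (`spark(A) > K+1`), and
`γ₁, γ₂ ∈ Θ_K` with `supp(γ₁) \ supp(γ₂) ≠ ∅`, then there is `c₁ > 0`, not depending on the
noise variance `σ²`, such that for every `σ² > 0` the largest eigenvalue of
`H = Σ_{γ₁}^{1/2} Σ_{γ₂}⁻¹ Σ_{γ₁}^{1/2}` is at least `c₁/σ²` (here `Q` is the positive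
semidefinite square root of `Σ_{γ₁}`, so `H = Q Σ_{γ₂}⁻¹ Q`). -/
theorem stmt13 {m n : ℕ} (A : Matrix (Fin m) (Fin n) ℝ) (K : ℕ)
    (hspark : ∀ S : Finset (Fin n), S.card ≤ K + 1 →
      LinearIndependent ℝ (fun j : {x // x ∈ S} => Aᵀ j.1))
    (γmin γmax : ℝ) (h0 : 0 < γmin) (h1 : γmin ≤ γmax)
    (γ1 γ2 : Fin n → ℝ)
    (hγ1 : InThetaK γ1 K γmin γmax) (hγ2 : InThetaK γ2 K γmin γmax)
    (hdiff : (suppF γ1 \ suppF γ2).Nonempty) :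
    ∃ c1 : ℝ, 0 < c1 ∧ ∀ s : ℝ, 0 < s →
      ∀ Q : Matrix (Fin m) (Fin m) ℝ, Q.PosSemidef → Q * Q = SigMat A s γ1 →
        ∃ lam : ℝ, c1 / s ≤ lam ∧ ∃ x : Fin m → ℝ, x ≠ 0 ∧
          (Q * (SigMat A s γ2)⁻¹ * Q).mulVec x = lam • x := by
  obtain ⟨i, hi⟩ := hdiff
  have hi1 : γ1 i ≠ 0 := by
    have := (Finset.mem_sdiff.1 hi).1
    simpa [suppF] using this
  have hi2 : i ∉ suppF γ2 := (Finset.mem_sdiff.1 hi).2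
  have hpos : 0 < γ1 i := h0.trans_le (hγ1.2 i hi1).1
  have hcard : (insert i (suppF γ2)).card ≤ K + 1 :=
    (Finset.card_insert_le _ _).trans (Nat.succ_le_succ hγ2.1)
  obtain ⟨w, hwi, hwj⟩ := exists_dotProduct_ne_zero_of_linearIndependent
    (hspark _ hcard) ⟨i, Finset.mem_insert_self _ _⟩
  replace hwj : ∀ j, γ2 j * (w ⬝ᵥ Aᵀ j) ^ 2 = 0 := fun j => by
    by_cases hj : γ2 j = 0
    · simp [hj]
    · have hmem : j ∈ suppF γ2 := by simpa [suppF] using hj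
      have := hwj ⟨j, Finset.mem_insert_of_mem hmem⟩
        (fun h => hi2 (by rwa [Subtype.mk.inj h] at hmem))
      simp only at this
      simp [this]
  have hw : w ≠ 0 := by
    rintro rfl
    simp at hwi
  have hww : 0 < w ⬝ᵥ w := by simpa using dotProduct_star_self_pos_iff.2 hw
  have hnum : 0 < γ1 i * (w ⬝ᵥ Aᵀ i) ^ 2 := mul_pos hpos (sq_pos_of_ne_zero hwi)
  refine ⟨γ1 i * (w ⬝ᵥ Aᵀ i) ^ 2 / (w ⬝ᵥ w), div_pos hnum hww, fun s hs Q hQ hQQ => ?_⟩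
  have hS2 := SigMat_posDef A hs (hγ2.nonneg h0)
  have hQt : Qᵀ = Q := by simpa [conjTranspose_eq_transpose_of_trivial] using hQ.1.eq
  have hQdot : ∀ y z : Fin m → ℝ, (Q *ᵥ y) ⬝ᵥ z = y ⬝ᵥ Q *ᵥ z := fun y z => by
    rw [dotProduct_mulVec, ← mulVec_transpose, hQt]
  have hH : (Q * (SigMat A s γ2)⁻¹ * Q).IsHermitian := by
    simpa only [hQ.1.eq] using isHermitian_mul_mul_conjTranspose Q hS2.inv.1
  have hnorm : (Q *ᵥ w) ⬝ᵥ (Q *ᵥ w) = w ⬝ᵥ SigMat A s γ1 *ᵥ w := by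
    rw [hQdot, mulVec_mulVec, hQQ]
  have hlow : γ1 i * (w ⬝ᵥ Aᵀ i) ^ 2 ≤ w ⬝ᵥ SigMat A s γ1 *ᵥ w := by
    rw [dotProduct_SigMat_mulVec]
    have := Finset.single_le_sum (f := fun j => γ1 j * (w ⬝ᵥ Aᵀ j) ^ 2)
      (fun j _ => mul_nonneg (hγ1.nonneg h0 j) (sq_nonneg _)) (Finset.mem_univ i)
    have := mul_pos hs hww
    simp only at *
    linarith
  have hden : w ⬝ᵥ SigMat A s γ2 *ᵥ w = s * (w ⬝ᵥ w) := by
    simp [dotProduct_SigMat_mulVec, hwj]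
  refine hH.exists_eigenvalue_ge (x := Q *ᵥ w) (fun h => ?_) ?_
  · rw [h, dotProduct_zero] at hnorm
    linarith
  · have hray : (Q *ᵥ w) ⬝ᵥ (Q * (SigMat A s γ2)⁻¹ * Q) *ᵥ (Q *ᵥ w) =
        (SigMat A s γ1 *ᵥ w) ⬝ᵥ (SigMat A s γ2)⁻¹ *ᵥ (SigMat A s γ1 *ᵥ w) := by
      rw [← hQQ, ← mulVec_mulVec, ← mulVec_mulVec, ← mulVec_mulVec, ← hQdot]
    have hcs := hS2.sq_dotProduct_le (SigMat A s γ1 *ᵥ w) w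
    rw [hden, dotProduct_comm _ w] at hcs
    rw [hray, hnorm, div_div, div_mul_eq_mul_div, div_le_iff₀ (mul_pos hww hs)]
    nlinarith [mul_le_mul_of_nonneg_right hlow (hnum.le.trans hlow)]
end

section
/- Let Σ₁ and Σ₂ be symmetric positive definite m×m real matrices, and let λ₁,…,λ_m > 0 be the eigenvalues of H := Σ₁^{1/2} Σ₂^{-1} Σ₁^{1/2}. Then log det( (Σ₁ + Σ₂)/2 ) − (1/2) log( det(Σ₁) det(Σ₂) ) = Σ_{i=1}^{m} log( (λ_i^{1/2} + λ_i^{-1/2})/2 ), and this quantity is at least log( (λ_max^{1/2} + λ_max^{-1/2})/2 ) ≥ 0, where λ_max is the largest eigenvalue of H. -/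
open Matrix BigOperators Polynomial

theorem Matrix.det_one_add_mul_inv_mul {n R : Type*} [Fintype n] [DecidableEq n] [CommRing R]
    {A Q : Matrix n n R} (hA : IsUnit A.det) :
    A.det * (1 + Q * A⁻¹ * Q).det = (Q * Q + A).det := by
  rw [Matrix.mul_assoc, Matrix.det_one_add_mul_comm, ← Matrix.det_mul, Matrix.mul_add,
    Matrix.mul_one, Matrix.mul_assoc, Matrix.mul_nonsing_inv_cancel_left _ _ hA, add_comm]

theorem Matrix.det_eq_prod_of_charpoly_eq_prod {n R : Type*} [Fintype n] [DecidableEq n]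
    [CommRing R] {M : Matrix n n R} {r : n → R} (h : M.charpoly = ∏ i, (X - C (r i))) :
    M.det = ∏ i, r i := by
  have h0 := congrArg (Polynomial.eval 0) h
  rw [Matrix.eval_charpoly, Polynomial.eval_prod] at h0
  exact (isUnit_one.neg.pow (Fintype.card n)).mul_left_cancel
    (by simpa [Matrix.det_neg, Finset.prod_neg] using h0)

theorem Matrix.det_one_add_eq_prod_of_charpoly_eq_prod {n R : Type*} [Fintype n]
    [DecidableEq n] [CommRing R] {M : Matrix n n R} {r : n → R}
    (h : M.charpoly = ∏ i, (X - C (r i))) :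
    (1 + M).det = ∏ i, (1 + r i) := by
  have h1 := congrArg (Polynomial.eval (-1)) h
  rw [Matrix.eval_charpoly, Polynomial.eval_prod] at h1
  have e : Matrix.scalar n (-1 : R) - M = -(1 + M) := by
    rw [map_neg, map_one, neg_add, sub_eq_add_neg]
  have e' : ∀ i, Polynomial.eval (-1) (X - C (r i)) = -(1 + r i) := fun i => by
    simp only [eval_sub, eval_X, eval_C]; ring
  rw [e, Matrix.det_neg, Finset.prod_congr rfl fun i _ => e' i, Finset.prod_neg] at h1
  exact (isUnit_one.neg.pow (Fintype.card n)).mul_left_cancel (by simpa using h1)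

theorem Real.log_sqrt_add_inv_sqrt_div_two {x : ℝ} (hx : 0 < x) :
    Real.log ((√x + (√x)⁻¹) / 2) = Real.log (1 + x) - Real.log 2 - 1 / 2 * Real.log x := by
  have hs : 0 < √x := Real.sqrt_pos.mpr hx
  have e : (√x + (√x)⁻¹) / 2 = (1 + x) / 2 / √x := by
    field_simp
    rw [Real.sq_sqrt hx.le, add_comm]
  rw [e, Real.log_div (by positivity) hs.ne', Real.log_div (by positivity) two_ne_zero,
    Real.log_sqrt hx.le]
  ring

theorem Real.log_sqrt_add_inv_sqrt_div_two_nonneg {x : ℝ} (hx : 0 < x) :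
    0 ≤ Real.log ((√x + (√x)⁻¹) / 2) := by
  have hs : 0 < √x := Real.sqrt_pos.mpr hx
  apply Real.log_nonneg
  rw [le_div_iff₀ two_pos, ← sub_nonneg]
  have e : √x + (√x)⁻¹ - 1 * 2 = (√x - 1) ^ 2 / √x := by
    field_simp
    ring
  rw [e]
  positivity

/-- For positive definite `Σ₁, Σ₂`, with `Q` the positive semidefinite square root of `Σ₁`
and `λ₁,…,λ_m > 0` the eigenvalues (with multiplicity) of `H = Q Σ₂⁻¹ Q = Σ₁^{1/2} Σ₂⁻¹ Σ₁^{1/2}`,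
the `1/2`-Rényi divergence `log det((Σ₁+Σ₂)/2) − (1/2) log(det Σ₁ · det Σ₂)` equals
`∑ᵢ log((√λᵢ + 1/√λᵢ)/2)`, and is at least `log((√λ_max + 1/√λ_max)/2) ≥ 0`. -/
theorem stmt15 {m : ℕ} (S1 S2 : Matrix (Fin m) (Fin m) ℝ)
    (h1 : S1.PosDef) (h2 : S2.PosDef)
    (Q : Matrix (Fin m) (Fin m) ℝ) (hQ : Q.PosSemidef) (hQQ : Q * Q = S1)
    (lam : Fin m → ℝ) (hpos : ∀ i, 0 < lam i)
    (hchar : (Q * S2⁻¹ * Q).charpoly = ∏ i, (X - C (lam i)))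
    (jmax : Fin m) (hmax : ∀ i, lam i ≤ lam jmax) :
    Real.log (((2 : ℝ)⁻¹ • (S1 + S2)).det) - (1 / 2) * Real.log (S1.det * S2.det) =
        (∑ i, Real.log ((Real.sqrt (lam i) + (Real.sqrt (lam i))⁻¹) / 2)) ∧
      Real.log ((Real.sqrt (lam jmax) + (Real.sqrt (lam jmax))⁻¹) / 2) ≤
        Real.log (((2 : ℝ)⁻¹ • (S1 + S2)).det) - (1 / 2) * Real.log (S1.det * S2.det) ∧
      0 ≤ Real.log ((Real.sqrt (lam jmax) + (Real.sqrt (lam jmax))⁻¹) / 2) := by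
  have d1 : 0 < S1.det := h1.det_pos
  have d2 : 0 < S2.det := h2.det_pos
  have hdet : S1.det = S2.det * ∏ i, lam i := by
    rw [← Matrix.det_eq_prod_of_charpoly_eq_prod hchar, Matrix.det_mul, Matrix.det_mul,
      Matrix.det_nonsing_inv, Ring.inverse_eq_inv', ← hQQ, Matrix.det_mul]
    field_simp
  have hadd : (S1 + S2).det = S2.det * ∏ i, (1 + lam i) := by
    rw [← Matrix.det_one_add_eq_prod_of_charpoly_eq_prod hchar,
      Matrix.det_one_add_mul_inv_mul d2.ne'.isUnit, hQQ]
  have hp1 : ∀ i, 1 + lam i ≠ 0 := fun i => by linarith [hpos i]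
  have hlog1 : Real.log S1.det = Real.log S2.det + ∑ i, Real.log (lam i) := by
    rw [hdet, Real.log_mul d2.ne' (Finset.prod_ne_zero_iff.mpr fun i _ => (hpos i).ne'),
      Real.log_prod fun i _ => (hpos i).ne']
  have key : Real.log (((2 : ℝ)⁻¹ • (S1 + S2)).det) - (1 / 2) * Real.log (S1.det * S2.det) =
      ∑ i, Real.log ((√(lam i) + (√(lam i))⁻¹) / 2) := by
    have hprod : ∏ i, (1 + lam i) ≠ 0 := Finset.prod_ne_zero_iff.mpr fun i _ => hp1 i
    rw [Finset.sum_congr rfl fun i _ => Real.log_sqrt_add_inv_sqrt_div_two (hpos i),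
      Finset.sum_sub_distrib, Finset.sum_sub_distrib, ← Finset.mul_sum, Matrix.det_smul, hadd,
      Real.log_mul (by positivity) (mul_ne_zero d2.ne' hprod), Real.log_mul d2.ne' hprod,
      Real.log_prod fun i _ => hp1 i, Real.log_mul d1.ne' d2.ne', hlog1, Real.log_pow,
      Real.log_inv]
    simp only [Finset.sum_const, Finset.card_univ, nsmul_eq_mul]
    ring
  refine ⟨key, ?_, Real.log_sqrt_add_inv_sqrt_div_two_nonneg (hpos jmax)⟩
  rw [key]
  exact Finset.single_le_sum
    (f := fun i => Real.log ((√(lam i) + (√(lam i))⁻¹) / 2))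
    (fun i _ => Real.log_sqrt_add_inv_sqrt_div_two_nonneg (hpos i)) (Finset.mem_univ jmax)
end
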